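/- For every x ∈ GL₂(H) and all p, q ∈ P, one has x* p x ∈ P, x* q x ∈ P, and d(x* p x, x* q x) = d(p, q); i.e., the congruence action of GL₂(H) on P is by isometries of the geodesic distance d. -/

import Mathlib

noncomputable section

open scoped InnerProductSpace

variable {H : Type*} [NormedAddCommGroup H] [InnerProductSpace ℂ H] [CompleteSpace H]
variable {ι : Type*}

/-- `A` is a Hilbert–Schmidt operator (w.r.t. the Hilbert basis `e`). -/
def IsHS (e : HilbertBasis ι ℂ H) (A : H →L[ℂ] H) : Prop :=
  Summable fun i => ‖A (e i)‖ ^ 2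

/-- The Hilbert–Schmidt norm of `A` (w.r.t. the Hilbert basis `e`). -/
def hsNorm (e : HilbertBasis ι ℂ H) (A : H →L[ℂ] H) : ℝ :=
  Real.sqrt (∑' i, ‖A (e i)‖ ^ 2)

/-- The real Hilbert–Schmidt inner product `⟨A, B⟩₂ = ∑ ⟪A eᵢ, B eᵢ⟫`. -/
def hsInner (e : HilbertBasis ι ℂ H) (A B : H →L[ℂ] H) : ℝ :=
  (∑' i, (inner ℂ (A (e i)) (B (e i)) : ℂ)).re

/-- The trace of an operator, `Tr T = ∑ ⟪eᵢ, T eᵢ⟫`. -/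
def opTrace (e : HilbertBasis ι ℂ H) (T : H →L[ℂ] H) : ℂ :=
  ∑' i, (inner ℂ (e i) (T (e i)) : ℂ)

/-- `T` is trace class: it is the product of two Hilbert–Schmidt operators. -/
def IsTraceClass (e : HilbertBasis ι ℂ H) (T : H →L[ℂ] H) : Prop :=
  ∃ B C : H →L[ℂ] H, IsHS e B ∧ IsHS e C ∧ T = B * C

/-- `A ∈ S₂(H)`: self-adjoint and Hilbert–Schmidt. -/
def MemS2 (e : HilbertBasis ι ℂ H) (A : H →L[ℂ] H) : Prop :=
  IsSelfAdjoint A ∧ IsHS e A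

/-- `p ∈ P`: self-adjoint, positive definite (invertible and `⟪p x, x⟫ ≥ 0`),
with `p - 1` Hilbert–Schmidt. -/
def MemP (e : HilbertBasis ι ℂ H) (p : H →L[ℂ] H) : Prop :=
  IsSelfAdjoint p ∧ IsUnit p ∧ (∀ x : H, 0 ≤ (inner ℂ (p x) x : ℂ).re) ∧ IsHS e (p - 1)

/-- `x ∈ GL₂(H)`: invertible with `x - 1` Hilbert–Schmidt. -/
def MemGL2 (e : HilbertBasis ι ℂ H) (x : H →L[ℂ] H) : Prop :=
  IsUnit x ∧ IsHS e (x - 1)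

/-- `x ∈ U₂(H)`: unitary with `x - 1` Hilbert–Schmidt. -/
def MemU2 (e : HilbertBasis ι ℂ H) (x : H →L[ℂ] H) : Prop :=
  x ∈ unitary (H →L[ℂ] H) ∧ IsHS e (x - 1)

/-- `p^{1/2}`, via continuous functional calculus. -/
def psqrt (p : H →L[ℂ] H) : H →L[ℂ] H := cfc Real.sqrt p

/-- `p^{-1/2}`, via continuous functional calculus. -/
def pinvsqrt (p : H →L[ℂ] H) : H →L[ℂ] H := cfc (fun t : ℝ => (Real.sqrt t)⁻¹) p

/-- `log p`, via continuous functional calculus. -/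
def plog (p : H →L[ℂ] H) : H →L[ℂ] H := cfc Real.log p

/-- The geodesic distance `d(p, q) = ‖log (p^{-1/2} q p^{-1/2})‖₂`. -/
def gdist (e : HilbertBasis ι ℂ H) (p q : H →L[ℂ] H) : ℝ :=
  hsNorm e (plog (pinvsqrt p * q * pinvsqrt p))

/-- The commutator `[A, B] = AB - BA`. -/
def brk (A B : H →L[ℂ] H) : H →L[ℂ] H := A * B - B * A

/-- The constant-speed geodesic `t ↦ p^{1/2} exp(t K) p^{1/2}`. -/
def geoCurve (p K : H →L[ℂ] H) (t : ℝ) : H →L[ℂ] H :=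
  psqrt p * NormedSpace.exp (t • K) * psqrt p

/-- The geodesic from `p` to `q`:
`t ↦ p^{1/2} exp(t log(p^{-1/2} q p^{-1/2})) p^{1/2}`. -/
def geodesic (p q : H →L[ℂ] H) (t : ℝ) : H →L[ℂ] H :=
  geoCurve p (plog (pinvsqrt p * q * pinvsqrt p)) t

/-- The image `exp E` of a set of operators under the exponential map. -/
def expSet (E : Set (H →L[ℂ] H)) : Set (H →L[ℂ] H) := NormedSpace.exp '' E

/-- The orthogonal complement of `E` inside `S₂(H)` for the Hilbert–Schmidt
inner product. -/
def hsPerp (e : HilbertBasis ι ℂ H) (E : Set (H →L[ℂ] H)) : Set (H →L[ℂ] H) :=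
  {Y | MemS2 e Y ∧ ∀ X ∈ E, hsInner e X Y = 0}

/-- `E` is closed in `S₂(H)` with respect to the Hilbert–Schmidt norm. -/
def IsHSClosed (e : HilbertBasis ι ℂ H) (E : Set (H →L[ℂ] H)) : Prop :=
  ∀ X : H →L[ℂ] H, MemS2 e X → (∀ ε > (0:ℝ), ∃ Y ∈ E, hsNorm e (X - Y) < ε) → X ∈ E

/-- The extended Hilbert–Schmidt norm squared. -/
def hsE (e : HilbertBasis ι ℂ H) (A : H →L[ℂ] H) : ENNReal := ∑' i, ‖A (e i)‖ₑ ^ 2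

theorem parseval_enorm (e : HilbertBasis ι ℂ H) (y : H) :
    ∑' i, ‖(inner ℂ (e i) y : ℂ)‖ₑ ^ 2 = ‖y‖ₑ ^ 2 := by
  have h := e.hasSum_inner_mul_inner y y
  have h2 : HasSum (fun i => ‖(inner ℂ (e i) y : ℂ)‖ ^ 2) (‖y‖ ^ 2) := by
    have h3 := Complex.hasSum_re h
    convert h3 using 1
    · ext i
      rw [← inner_conj_symm y (e i), ← Complex.normSq_eq_conj_mul_self, Complex.ofReal_re,
        Complex.normSq_eq_norm_sq]
    · exact norm_sq_eq_re_inner (𝕜 := ℂ) y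
  have h4 := ENNReal.ofReal_tsum_of_nonneg (fun i => sq_nonneg _) h2.summable
  rw [h2.tsum_eq] at h4
  simp only [ENNReal.ofReal_pow (norm_nonneg _), ofReal_norm] at h4
  exact h4.symm

theorem hsE_star (e : HilbertBasis ι ℂ H) (A : H →L[ℂ] H) : hsE e (star A) = hsE e A := by
  unfold hsE
  calc ∑' i, ‖(star A) (e i)‖ₑ ^ 2
      = ∑' i, ∑' j, ‖(inner ℂ (e j) ((star A) (e i)) : ℂ)‖ₑ ^ 2 := by
        simp_rw [parseval_enorm]
    _ = ∑' j, ∑' i, ‖(inner ℂ (e j) ((star A) (e i)) : ℂ)‖ₑ ^ 2 := ENNReal.tsum_comm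
    _ = ∑' j, ∑' i, ‖(inner ℂ (e i) (A (e j)) : ℂ)‖ₑ ^ 2 := by
        refine tsum_congr fun j => tsum_congr fun i => ?_
        rw [ContinuousLinearMap.star_eq_adjoint, ContinuousLinearMap.adjoint_inner_right,
          ← inner_conj_symm, RCLike.enorm_conj]
    _ = _ := by simp_rw [parseval_enorm]

theorem hsE_mul_le (e : HilbertBasis ι ℂ H) (B A : H →L[ℂ] H) :
    hsE e (B * A) ≤ ‖B‖ₑ ^ 2 * hsE e A := by
  unfold hsE
  rw [← ENNReal.tsum_mul_left]
  refine ENNReal.tsum_le_tsum fun i => ?_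
  rw [← mul_pow]
  gcongr
  exact B.le_opENorm _

theorem isHS_iff (e : HilbertBasis ι ℂ H) (A : H →L[ℂ] H) : IsHS e A ↔ hsE e A ≠ ⊤ := by
  have : hsE e A = ∑' i, ((‖A (e i)‖₊ ^ 2 : NNReal) : ENNReal) := by
    simp [hsE, enorm_eq_nnnorm]
  rw [this, ENNReal.tsum_coe_ne_top_iff_summable, ← NNReal.summable_coe]
  simp [IsHS]

theorem hsNorm_eq (e : HilbertBasis ι ℂ H) (A : H →L[ℂ] H) :
    hsNorm e A = Real.sqrt (hsE e A).toReal := by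
  unfold hsNorm hsE
  rw [ENNReal.tsum_toReal_eq (fun i => by simp)]
  simp

theorem IsHS.star' {e : HilbertBasis ι ℂ H} {A : H →L[ℂ] H} (h : IsHS e A) :
    IsHS e (star A) := by
  rw [isHS_iff, hsE_star]; exact (isHS_iff e A).1 h

theorem IsHS.mul_left' {e : HilbertBasis ι ℂ H} {A : H →L[ℂ] H} (h : IsHS e A)
    (B : H →L[ℂ] H) : IsHS e (B * A) := by
  rw [isHS_iff] at *
  exact ne_top_of_le_ne_top (ENNReal.mul_ne_top (by simp) h) (hsE_mul_le e B A)

theorem IsHS.mul_right' {e : HilbertBasis ι ℂ H} {A : H →L[ℂ] H} (h : IsHS e A)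
    (B : H →L[ℂ] H) : IsHS e (A * B) := by
  have := (h.star'.mul_left' (star B)).star'
  simpa using this

theorem IsHS.add' {e : HilbertBasis ι ℂ H} {A B : H →L[ℂ] H} (hA : IsHS e A)
    (hB : IsHS e B) : IsHS e (A + B) := by
  unfold IsHS at *
  refine Summable.of_nonneg_of_le (fun i => sq_nonneg _) (fun i => ?_)
    ((hA.add hB).mul_left 2)
  have h1 : ‖(A + B) (e i)‖ ≤ ‖A (e i)‖ + ‖B (e i)‖ := norm_add_le _ _
  have h2 := norm_nonneg ((A + B) (e i))
  nlinarith [sq_nonneg (‖A (e i)‖ - ‖B (e i)‖)]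

theorem unitary_norm {u : H →L[ℂ] H} (hu : star u * u = 1) (y : H) : ‖u y‖ₑ = ‖y‖ₑ := by
  rw [← ofReal_norm, ← ofReal_norm]
  congr 1
  exact (ContinuousLinearMap.norm_map_iff_adjoint_comp_self u).2 hu y

theorem hsE_conj (e : HilbertBasis ι ℂ H) (A u : H →L[ℂ] H) (h1 : star u * u = 1)
    (h2 : u * star u = 1) : hsE e (star u * A * u) = hsE e A := by
  have key : ∀ (v B : H →L[ℂ] H), star v * v = 1 → hsE e (v * B) = hsE e B := by
    intro v B hv
    unfold hsE
    exact tsum_congr fun i => by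
      have h : (v * B) (e i) = v (B (e i)) := rfl
      rw [h, unitary_norm hv]
  have hs : star (star u) * star u = 1 := by simpa using h2
  rw [mul_assoc, key _ _ hs, ← hsE_star, star_mul, key _ _ hs, hsE_star]

theorem MemP.nonneg {e : HilbertBasis ι ℂ H} {p : H →L[ℂ] H} (hp : MemP e p) : 0 ≤ p := by
  rw [ContinuousLinearMap.nonneg_iff_isPositive, ContinuousLinearMap.isPositive_def']
  exact ⟨hp.1, hp.2.2.1⟩

theorem MemP.spec {e : HilbertBasis ι ℂ H} {p : H →L[ℂ] H} (hp : MemP e p) :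
    ∀ t ∈ spectrum ℝ p, 0 < t := by
  intro t ht
  refine lt_of_le_of_ne (spectrum_nonneg_of_nonneg hp.nonneg ht) ?_
  rintro rfl
  exact spectrum.zero_notMem ℝ hp.2.1 ht

theorem MemP.cont {e : HilbertBasis ι ℂ H} {p : H →L[ℂ] H} (hp : MemP e p) :
    ContinuousOn (fun t : ℝ => (Real.sqrt t)⁻¹) (spectrum ℝ p) :=
  Real.continuous_sqrt.continuousOn.inv₀ fun t ht => (Real.sqrt_pos.2 (hp.spec t ht)).ne'

theorem MemP.sqrt_mul_sqrt {e : HilbertBasis ι ℂ H} {p : H →L[ℂ] H} (hp : MemP e p) :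
    psqrt p * psqrt p = p := by
  have hsa : IsSelfAdjoint p := hp.1
  unfold psqrt
  rw [← cfc_mul Real.sqrt Real.sqrt p Real.continuous_sqrt.continuousOn
    Real.continuous_sqrt.continuousOn]
  conv_rhs => rw [← cfc_id ℝ p]
  exact cfc_congr fun t ht => Real.mul_self_sqrt (hp.spec t ht).le

theorem MemP.sqrt_mul_inv {e : HilbertBasis ι ℂ H} {p : H →L[ℂ] H} (hp : MemP e p) :
    psqrt p * pinvsqrt p = 1 := by
  have hsa : IsSelfAdjoint p := hp.1
  unfold psqrt pinvsqrt
  rw [← cfc_mul Real.sqrt _ p Real.continuous_sqrt.continuousOn hp.cont]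
  rw [← cfc_one ℝ p]
  exact cfc_congr fun t ht => mul_inv_cancel₀ (Real.sqrt_pos.2 (hp.spec t ht)).ne'

theorem MemP.inv_mul_sqrt {e : HilbertBasis ι ℂ H} {p : H →L[ℂ] H} (hp : MemP e p) :
    pinvsqrt p * psqrt p = 1 := by
  have hsa : IsSelfAdjoint p := hp.1
  unfold psqrt pinvsqrt
  rw [← cfc_mul _ Real.sqrt p hp.cont Real.continuous_sqrt.continuousOn]
  rw [← cfc_one ℝ p]
  exact cfc_congr fun t ht => inv_mul_cancel₀ (Real.sqrt_pos.2 (hp.spec t ht)).ne'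

theorem psqrt_star (p : H →L[ℂ] H) : star (psqrt p) = psqrt p :=
  (cfc_predicate (R := ℝ) Real.sqrt p : IsSelfAdjoint _)

theorem pinvsqrt_star (p : H →L[ℂ] H) : star (pinvsqrt p) = pinvsqrt p :=
  (cfc_predicate (R := ℝ) (fun t : ℝ => (Real.sqrt t)⁻¹) p : IsSelfAdjoint _)

theorem memP_conj {e : HilbertBasis ι ℂ H} {x p : H →L[ℂ] H} (hx : MemGL2 e x)
    (hp : MemP e p) : MemP e (star x * p * x) := by
  refine ⟨hp.1.conjugate' x, (hx.1.star.mul hp.2.1).mul hx.1, fun y => ?_, ?_⟩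
  · have := hp.2.2.1 (x y)
    have h : (star x * p * x) y = (ContinuousLinearMap.adjoint x) (p (x y)) := rfl
    rw [h, ContinuousLinearMap.adjoint_inner_left]
    exact this
  · have h : star x * p * x - 1 =
        star x * (p - 1) * x + (star x * (x - 1) + star (x - 1)) := by
      rw [star_sub, star_one]; noncomm_ring
    rw [h]
    exact ((hp.2.2.2.mul_left' _).mul_right' _).add' ((hx.2.mul_left' _).add' hx.2.star')

theorem plog_conj (m u : H →L[ℂ] H) (hm : IsSelfAdjoint m) (hmu : IsUnit m)
    (h1 : star u * u = 1) (h2 : u * star u = 1) :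
    plog (star u * m * u) = star u * plog m * u := by
  have hU : star u ∈ unitary (H →L[ℂ] H) := by
    rw [Unitary.mem_iff]; simp [h1, h2]
  have := StarAlgHomClass.map_cfc (S := ℂ) (R := ℝ) (p := IsSelfAdjoint) (q := IsSelfAdjoint)
    (Unitary.conjStarAlgAut ℂ (H →L[ℂ] H) ⟨star u, hU⟩) Real.log m
    (Real.continuousOn_log.mono fun t ht => by
      rintro rfl
      exact spectrum.zero_notMem ℝ hmu ht)
    (by
      have : (Unitary.conjStarAlgAut ℂ (H →L[ℂ] H) ⟨star u, hU⟩ : (H →L[ℂ] H) → (H →L[ℂ] H))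
          = fun y => star u * y * u := by
        ext1 y; simp
      rw [this]; fun_prop) hm (by
      simpa using hm.conjugate' u)
  simpa [plog] using this.symm

theorem gdist_conj (e : HilbertBasis ι ℂ H) (x p q : H →L[ℂ] H)
    (hx : MemGL2 e x) (hp : MemP e p) (hq : MemP e q) :
    gdist e (star x * p * x) (star x * q * x) = gdist e p q := by
  have hp' := memP_conj hx hp
  set p' := star x * p * x with hp'def
  set u := psqrt p * x * pinvsqrt p' with hu
  have hsu : star u = pinvsqrt p' * star x * psqrt p := by
    rw [hu, star_mul, star_mul, psqrt_star, pinvsqrt_star, mul_assoc]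
  have h1 : star u * u = 1 := by
    calc star u * u = pinvsqrt p' * (star x * (psqrt p * psqrt p) * x) * pinvsqrt p' := by
          rw [hsu, hu]; noncomm_ring
      _ = pinvsqrt p' * (psqrt p' * psqrt p') * pinvsqrt p' := by
          rw [hp.sqrt_mul_sqrt, ← hp'def, hp'.sqrt_mul_sqrt]
      _ = (pinvsqrt p' * psqrt p') * (psqrt p' * pinvsqrt p') := by noncomm_ring
      _ = 1 := by rw [hp'.inv_mul_sqrt, hp'.sqrt_mul_inv, one_mul]
  have hi1 : IsUnit (psqrt p) := ⟨⟨_, _, hp.sqrt_mul_inv, hp.inv_mul_sqrt⟩, rfl⟩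
  have hi2 : IsUnit (pinvsqrt p) := ⟨⟨_, _, hp.inv_mul_sqrt, hp.sqrt_mul_inv⟩, rfl⟩
  have hi3 : IsUnit (pinvsqrt p') := ⟨⟨_, _, hp'.inv_mul_sqrt, hp'.sqrt_mul_inv⟩, rfl⟩
  have huu : IsUnit u := (hi1.mul hx.1).mul hi3
  have h2 : u * star u = 1 := by
    obtain ⟨v, hv⟩ := huu
    rw [← hv] at h1 ⊢
    rw [Units.eq_inv_of_mul_eq_one_right h1, Units.mul_inv]
  have hm : pinvsqrt p' * (star x * q * x) * pinvsqrt p' =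
      star u * (pinvsqrt p * q * pinvsqrt p) * u := by
    calc _ = pinvsqrt p' * (star x * 1 * q * 1 * x) * pinvsqrt p' := by simp
      _ = pinvsqrt p' * (star x * (psqrt p * pinvsqrt p) * q * (pinvsqrt p * psqrt p) * x)
            * pinvsqrt p' := by rw [hp.sqrt_mul_inv, hp.inv_mul_sqrt]
      _ = _ := by rw [hsu, hu]; noncomm_ring
  have hmsa : IsSelfAdjoint (pinvsqrt p * q * pinvsqrt p) := by
    have := hq.1.conjugate' (pinvsqrt p)
    rwa [pinvsqrt_star] at this
  unfold gdist
  rw [hm, plog_conj _ u hmsa ((hi2.mul hq.2.1).mul hi2) h1 h2, hsNorm_eq, hsNorm_eq,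
    hsE_conj e _ u h1 h2]

/-- For `x ∈ GL₂(H)` and `p, q ∈ P` one has `x* p x ∈ P`,
`x* q x ∈ P` and `d(x* p x, x* q x) = d(p, q)`: the congruence action of `GL₂(H)`
on `P` is by isometries of the geodesic distance. -/
theorem statement18 (e : HilbertBasis ι ℂ H) (x p q : H →L[ℂ] H)
    (hx : MemGL2 e x) (hp : MemP e p) (hq : MemP e q) :
    MemP e (ContinuousLinearMap.adjoint x * p * x) ∧
    MemP e (ContinuousLinearMap.adjoint x * q * x) ∧
    gdist e (ContinuousLinearMap.adjoint x * p * x)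
      (ContinuousLinearMap.adjoint x * q * x) = gdist e p q := by
  exact ⟨memP_conj hx hp, memP_conj hx hq, gdist_conj e x p q hx hp hq⟩
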